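/- Let R be a Prüfer domain with countably many maximal ideals and M a torsion-free R-module of projective dimension at most 1. Then M has a G(ℵ0)-family consisting of pure submodules. -/

import Mathlib

open DirectSum Cardinal

universe u v w

variable (R : Type u) [CommRing R] [IsDomain R]

/-- A submodule `N` of `M` is *pure* if every finite system of `R`-linear equations with
constants in `N` that is solvable in `M` is solvable in `N`. -/
def IsPureSub {M : Type v} [AddCommGroup M] [Module R M] (N : Submodule R M) : Prop :=
  ∀ (n m : ℕ) (r : Fin n → Fin m → R) (a : Fin n → M),
    (∀ i, a i ∈ N) →
    (∃ x : Fin m → M, ∀ i, ∑ j, r i j • x j = a i) →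
    (∃ y : Fin m → M, (∀ j, y j ∈ N) ∧ ∀ i, ∑ j, r i j • y j = a i)

/-- A submodule `A ≤ B` is *balanced* if `B/A` is torsion-free and every rank-1
torsion-free module has the projective property w.r.t. `0 → A → B → B/A → 0`. -/
def IsBalanced {B : Type v} [AddCommGroup B] [Module R B] (A : Submodule R B) : Prop :=
  NoZeroSMulDivisors R (B ⧸ A) ∧
  ∀ (J : Type w) [AddCommGroup J] [Module R J], NoZeroSMulDivisors R J →
    Module.rank R J = 1 →
    ∀ φ : J →ₗ[R] B ⧸ A, ∃ ψ : J →ₗ[R] B, A.mkQ ∘ₗ ψ = φ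

/-- `M` is isomorphic to a direct sum of ideals of `R`. -/
def IsDirectSumOfIdeals (M : Type v) [AddCommGroup M] [Module R M] : Prop :=
  ∃ (ι : Type w) (I : ι → Ideal R), Nonempty (M ≃ₗ[R] ⨁ i, ↥(I i))

/-- `R` is an h-local domain. -/
def IsHLocal : Prop :=
  (∀ P : Ideal R, P.IsPrime → P ≠ ⊥ → ∃! m : Ideal R, m.IsMaximal ∧ P ≤ m) ∧
  (∀ r : R, r ≠ 0 → {m : Ideal R | m.IsMaximal ∧ r ∈ m}.Finite)

/-- `R` is a Prüfer domain: finitely generated ideals are projective. -/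
def IsPruefer : Prop := ∀ I : Ideal R, I.FG → Module.Projective R ↥I

/-- A `G(ℵ₀)`-family of submodules of `M`. -/
def IsGAleph0Family {M : Type v} [AddCommGroup M] [Module R M]
    (𝓑 : Set (Submodule R M)) : Prop :=
  ⊥ ∈ 𝓑 ∧ ⊤ ∈ 𝓑 ∧
  (∀ c ⊆ 𝓑, c.Nonempty → IsChain (· ≤ ·) c → sSup c ∈ 𝓑) ∧
  (∀ A₀ ∈ 𝓑, ∀ H : Set M, H.Countable →
    ∃ A ∈ 𝓑, A₀ ≤ A ∧ H ⊆ (A : Set M) ∧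
      ∃ S : Set M, S.Countable ∧ S ⊆ (A : Set M) ∧ A ≤ A₀ ⊔ Submodule.span R S)

set_option linter.unusedSectionVars false

section Hill

variable {M : Type v} [AddCommGroup M] [Module R M]

/-- Sum of the pieces indexed by `S`. -/
def hsum {ι : Type w} (B : ι → Submodule R M) (S : Set ι) : Submodule R M := ⨆ i : S, B i

variable {R}

theorem hsum_mono {ι : Type w} (B : ι → Submodule R M) {S T : Set ι} (h : S ⊆ T) :
    hsum R B S ≤ hsum R B T :=
  iSup_le fun i => le_iSup (fun i : T => B i) ⟨i.1, h i.2⟩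

theorem le_hsum {ι : Type w} (B : ι → Submodule R M) {S : Set ι} {i : ι} (h : i ∈ S) :
    B i ≤ hsum R B S := le_iSup (fun i : S => B i) ⟨i, h⟩

theorem hsum_decomp {ι : Type w} [LinearOrder ι] (B : ι → Submodule R M) {S : Set ι} {x : M}
    (hx : x ∈ hsum R B S) :
    x = 0 ∨ ∃ j ∈ S, ∃ y ∈ hsum R B (S ∩ Set.Iio j), ∃ b ∈ B j, x = y + b := by
  have h1 : x = 0 ∨ ∃ j ∈ S, x ∈ hsum R B (S ∩ Set.Iic j) := by
    unfold hsum at hx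
    refine Submodule.iSup_induction (fun i : S => B i)
      (motive := fun x => x = 0 ∨ ∃ j ∈ S, x ∈ hsum R B (S ∩ Set.Iic j)) hx ?_ (Or.inl rfl) ?_
    · intro i x hx
      exact Or.inr ⟨i, i.2, le_hsum B (show (i : ι) ∈ S ∩ Set.Iic (i : ι) from ⟨i.2, le_refl _⟩) hx⟩
    · rintro x y (rfl | ⟨j, hj, hx⟩) (rfl | ⟨k, hk, hy⟩)
      · simp
      · right; exact ⟨k, hk, by simpa using hy⟩
      · right; exact ⟨j, hj, by simpa using hx⟩
      · right
        rcases le_total j k with h | h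
        · exact ⟨k, hk, add_mem (hsum_mono B
            (Set.inter_subset_inter_right _ (Set.Iic_subset_Iic.2 h)) hx) hy⟩
        · exact ⟨j, hj, add_mem hx (hsum_mono B
            (Set.inter_subset_inter_right _ (Set.Iic_subset_Iic.2 h)) hy)⟩
  rcases h1 with h | ⟨j, hj, hx⟩
  · exact Or.inl h
  · right
    refine ⟨j, hj, ?_⟩
    have : hsum R B (S ∩ Set.Iic j) ≤ hsum R B (S ∩ Set.Iio j) ⊔ B j := by
      refine iSup_le fun ⟨i, hi, hij⟩ => ?_
      rcases lt_or_eq_of_le (show i ≤ j from hij) with h | h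
      · exact (le_hsum B (show i ∈ S ∩ Set.Iio j from ⟨hi, h⟩)).trans le_sup_left
      · subst h; exact le_sup_right
    obtain ⟨y, hy, b, hb, h⟩ := Submodule.mem_sup.1 (this hx)
    exact ⟨y, hy, b, hb, h.symm⟩

theorem hill_key {ι : Type w} [LinearOrder ι] [WellFoundedLT ι] (B : ι → Submodule R M)
    (C : ι → Set ι) (hClt : ∀ i, C i ⊆ Set.Iio i)
    (hC : ∀ i, B i ⊓ hsum R B (Set.Iio i) ≤ hsum R B (C i))
    {S : Set ι} (hS : ∀ i ∈ S, C i ⊆ S) {i : ι} (hi : i ∉ S) {x : M} (hx : x ∈ hsum R B S)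
    (hxi : x ∈ hsum R B (Set.Iic i)) : x ∈ hsum R B (Set.Iio i) := by
  have key : ∀ j : ι, j ∈ S → ∀ y ∈ hsum R B (S ∩ Set.Iio j), ∀ b ∈ B j,
      y + b ∈ hsum R B (Set.Iic i) → y + b ∈ hsum R B (Set.Iio i) := by
    intro j
    induction j using WellFoundedLT.induction with
    | ind j ih =>
      intro hj y hy b hb hyb
      rcases lt_trichotomy j i with h | h | h
      · refine add_mem (hsum_mono B ?_ hy) (le_hsum B (Set.mem_Iio.2 h) hb)
        rintro k ⟨-, hk⟩
        exact lt_trans hk h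
      · subst h; exact absurd hj hi
      · have hbN : b ∈ hsum R B (Set.Iio j) := by
          have h1 : y + b ∈ hsum R B (Set.Iio j) :=
            hsum_mono B (fun k hk => lt_of_le_of_lt hk h) hyb
          have h2 : y ∈ hsum R B (Set.Iio j) := hsum_mono B Set.inter_subset_right hy
          simpa using sub_mem h1 h2
        have hb' : b ∈ hsum R B (S ∩ Set.Iio j) :=
          hsum_mono B (Set.subset_inter (hS j hj) (hClt j)) (hC j ⟨hb, hbN⟩)
        rcases hsum_decomp B (add_mem hy hb') with h0 | ⟨k, ⟨hkS, hkj⟩, z, hz, c, hc, hzc⟩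
        · rw [h0]; exact zero_mem _
        · rw [hzc] at hyb ⊢
          exact ih k hkj hkS z (hsum_mono B (show S ∩ Set.Iio j ∩ Set.Iio k ⊆ S ∩ Set.Iio k from
            fun l hl => ⟨hl.1.1, hl.2⟩) hz) c hc hyb
  rcases hsum_decomp B hx with rfl | ⟨j, hj, y, hy, b, hb, rfl⟩
  · exact zero_mem _
  · exact key j hj y hy b hb hxi

theorem hill_pure {ι : Type w} [LinearOrder ι] [WellFoundedLT ι] (B : ι → Submodule R M)
    (hB : hsum R B Set.univ = ⊤)
    (hN : ∀ i, ∀ r : R, r ≠ 0 → ∀ m : M, r • m ∈ hsum R B (Set.Iio i) → m ∈ hsum R B (Set.Iio i))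
    (C : ι → Set ι) (hClt : ∀ i, C i ⊆ Set.Iio i)
    (hC : ∀ i, B i ⊓ hsum R B (Set.Iio i) ≤ hsum R B (C i))
    {S : Set ι} (hS : ∀ i ∈ S, C i ⊆ S) (r : R) (hr : r ≠ 0) (m : M)
    (hm : r • m ∈ hsum R B S) : m ∈ hsum R B S := by
  have key : ∀ j : ι, ∀ y ∈ hsum R B (Set.Iio j), ∀ b ∈ B j,
      r • (y + b) ∈ hsum R B S → y + b ∈ hsum R B S := by
    intro j
    induction j using WellFoundedLT.induction with
    | ind j ih =>
      intro y hy b hb hyb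
      have main : ∀ z ∈ hsum R B (Set.Iio j), r • z ∈ hsum R B S → z ∈ hsum R B S := by
        intro z hz hrz
        rcases hsum_decomp B hz with rfl | ⟨k, hk, z', hz', c, hc, rfl⟩
        · exact zero_mem _
        · exact ih k hk z' (hsum_mono B Set.inter_subset_right hz') c hc hrz
      by_cases hj : j ∈ S
      · have hbS : b ∈ hsum R B S := le_hsum B hj hb
        refine add_mem (main y hy ?_) hbS
        have := sub_mem hyb (Submodule.smul_mem _ r hbS)
        simpa [smul_add] using this
      · refine main _ (hN j r hr _ (hill_key B C hClt hC hS hj hyb ?_)) hyb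
        exact Submodule.smul_mem _ _ (add_mem
          (hsum_mono B Set.Iio_subset_Iic_self hy) (le_hsum B (Set.mem_Iic.2 le_rfl) hb))
  have hm' : m ∈ hsum R B Set.univ := hB ▸ Submodule.mem_top
  rcases hsum_decomp B hm' with rfl | ⟨j, -, y, hy, b, hb, rfl⟩
  · exact zero_mem _
  · exact key j y (hsum_mono B Set.inter_subset_right hy) b hb hm

theorem hsum_countable {ι : Type w} (B : ι → Submodule R M) {S : Set ι}
    (H : Set M) (hH : H.Countable) (hHS : H ⊆ hsum R B S) :
    ∃ T : Set ι, T.Countable ∧ T ⊆ S ∧ H ⊆ hsum R B T := by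
  have : ∀ x : M, x ∈ hsum R B S → ∃ T : Set ι, T.Countable ∧ T ⊆ S ∧ x ∈ hsum R B T := by
    intro x hx
    unfold hsum at hx
    refine Submodule.iSup_induction (fun i : S => B i)
      (motive := fun x => ∃ T : Set ι, T.Countable ∧ T ⊆ S ∧ x ∈ hsum R B T) hx ?_ ?_ ?_
    · intro i x hx
      exact ⟨{i.1}, Set.countable_singleton _, by simp, le_hsum B (Set.mem_singleton _) hx⟩
    · exact ⟨∅, Set.countable_empty, by simp, zero_mem _⟩
    · rintro x y ⟨T, h1, h2, h3⟩ ⟨T', h1', h2', h3'⟩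
      exact ⟨T ∪ T', h1.union h1', Set.union_subset h2 h2',
        add_mem (hsum_mono B Set.subset_union_left h3) (hsum_mono B Set.subset_union_right h3')⟩
  choose! T h1 h2 h3 using this
  refine ⟨⋃ x ∈ H, T x, hH.biUnion fun x hx => h1 x (hHS hx),
    Set.iUnion₂_subset fun x hx => h2 x (hHS hx), fun x hx => ?_⟩
  exact hsum_mono B (Set.subset_biUnion_of_mem (u := T) hx) (h3 x (hHS hx))

theorem countable_closure {ι : Type w} (C : ι → Set ι) (hCc : ∀ i, (C i).Countable)
    (T : Set ι) (hT : T.Countable) :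
    ∃ U : Set ι, T ⊆ U ∧ U.Countable ∧ ∀ i ∈ U, C i ⊆ U := by
  let f : ℕ → Set ι := fun n => Nat.rec T (fun _ V => ⋃ i ∈ V, C i) n
  have hf : ∀ n, (f n).Countable := by
    intro n
    induction n with
    | zero => exact hT
    | succ n ih => exact ih.biUnion fun i _ => hCc i
  refine ⟨⋃ n, f n, Set.subset_iUnion f 0, Set.countable_iUnion hf, ?_⟩
  intro i hi j hj
  obtain ⟨n, hn⟩ := Set.mem_iUnion.1 hi
  refine Set.mem_iUnion.2 ⟨n + 1, ?_⟩
  exact Set.mem_biUnion (t := C) hn hj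

theorem hill_family {ι : Type w} [LinearOrder ι] [WellFoundedLT ι] (B : ι → Submodule R M)
    (hB : hsum R B Set.univ = ⊤)
    (hBc : ∀ i, ∃ s : Set M, s.Countable ∧ B i = Submodule.span R s)
    (hN : ∀ i, ∀ r : R, r ≠ 0 → ∀ m : M, r • m ∈ hsum R B (Set.Iio i) → m ∈ hsum R B (Set.Iio i))
    (hC : ∀ i, ∃ H : Set M, H.Countable ∧ H ⊆ hsum R B (Set.Iio i) ∧
      B i ⊓ hsum R B (Set.Iio i) ≤ Submodule.span R H) :
    ∃ 𝓑 : Set (Submodule R M), IsGAleph0Family R 𝓑 ∧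
      ∀ A ∈ 𝓑, ∀ r : R, r ≠ 0 → ∀ m : M, r • m ∈ A → m ∈ A := by
  have : ∀ i, ∃ C : Set ι, C.Countable ∧ C ⊆ Set.Iio i ∧
      B i ⊓ hsum R B (Set.Iio i) ≤ hsum R B C := by
    intro i
    obtain ⟨H, h1, h2, h3⟩ := hC i
    obtain ⟨T, t1, t2, t3⟩ := hsum_countable B H h1 h2
    exact ⟨T, t1, t2, h3.trans (Submodule.span_le.2 t3)⟩
  choose C hCc hClt hC using this
  choose s hsc hs using hBc
  refine ⟨{A | ∃ S : Set ι, (∀ i ∈ S, C i ⊆ S) ∧ A = hsum R B S}, ⟨?_, ?_, ?_, ?_⟩, ?_⟩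
  · refine ⟨∅, by simp, ?_⟩
    exact (iSup_of_empty _).symm
  · exact ⟨Set.univ, by simp, hB.symm⟩
  · intro c hc _ _
    have hc' : ∀ A, A ∈ c → ∃ S : Set ι, (∀ i ∈ S, C i ⊆ S) ∧ A = hsum R B S := fun A h => hc h
    choose! S hS hA using hc'
    refine ⟨⋃ A ∈ c, S A, ?_, ?_⟩
    · intro i hi
      obtain ⟨A, hAc, hi⟩ := Set.mem_iUnion₂.1 hi
      exact (hS A hAc i hi).trans (Set.subset_biUnion_of_mem (u := S) hAc)
    · apply le_antisymm
      · refine sSup_le fun A hAc => ?_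
        rw [hA A hAc]
        exact hsum_mono B (Set.subset_biUnion_of_mem (u := S) hAc)
      · refine iSup_le fun ⟨i, hi⟩ => ?_
        obtain ⟨A, hAc, hi⟩ := Set.mem_iUnion₂.1 hi
        refine le_trans ?_ (le_sSup hAc)
        rw [hA A hAc]
        exact le_hsum B hi
  · rintro A₀ ⟨S, hS, rfl⟩ H hH
    obtain ⟨T, t1, -, t3⟩ := hsum_countable B (S := Set.univ) H hH (by rw [hB]; simp)
    obtain ⟨U, u1, u2, u3⟩ := countable_closure C hCc T t1
    refine ⟨hsum R B (S ∪ U), ⟨S ∪ U, ?_, rfl⟩, hsum_mono B Set.subset_union_left,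
      t3.trans (hsum_mono B (u1.trans Set.subset_union_right)), ⋃ i ∈ U, s i,
      u2.biUnion fun i _ => hsc i, ?_, ?_⟩
    · rintro i (hi | hi)
      · exact (hS i hi).trans Set.subset_union_left
      · exact (u3 i hi).trans Set.subset_union_right
    · refine Set.iUnion₂_subset fun i hi => ?_
      refine Set.Subset.trans ?_ (le_hsum B (Set.mem_union_right S hi))
      rw [hs i]
      exact Submodule.subset_span
    · refine iSup_le fun ⟨i, hi⟩ => ?_
      rcases hi with hi | hi
      · exact (le_hsum B hi).trans le_sup_left
      · refine le_trans ?_ le_sup_right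
        show B i ≤ _
        rw [hs i]
        exact Submodule.span_mono (Set.subset_biUnion_of_mem (u := s) hi)
  · rintro A ⟨S, hS, rfl⟩ r hr m hm
    exact hill_pure B hB hN C hClt hC hS r hr m hm

end Hill

section Local

variable {R}

theorem pruefer_two (hP : IsPruefer R) (P : Ideal R) [P.IsPrime] (a b : R) :
    ∃ s, s ∉ P ∧ (b ∣ s * a ∨ a ∣ s * b) := by
  classical
  by_cases ha : a = 0
  · exact ⟨1, fun h => (Ideal.IsPrime.ne_top ‹_›) ((Ideal.eq_top_iff_one _).2 h), by simp [ha]⟩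
  let I : Ideal R := Ideal.span {a, b}
  have haI : a ∈ I := Ideal.subset_span (by simp)
  have hbI : b ∈ I := Ideal.subset_span (by simp)
  have hproj : Module.Projective R I := hP I ⟨{a, b}, by simp [I, Ideal.span]⟩
  let g : (R × R) →ₗ[R] I :=
    (LinearMap.toSpanSingleton R I ⟨a, haI⟩).coprod (LinearMap.toSpanSingleton R I ⟨b, hbI⟩)
  have hg : Function.Surjective g := by
    rintro ⟨x, hx⟩
    obtain ⟨c, d, h⟩ := Ideal.mem_span_pair.1 hx
    exact ⟨(c, d), Subtype.ext (by simpa [g] using h)⟩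
  obtain ⟨σ, hσ⟩ := Module.projective_lifting_property g LinearMap.id hg
  let a' : I := ⟨a, haI⟩
  let b' : I := ⟨b, hbI⟩
  have hab : a • σ b' = b • σ a' := by
    rw [← map_smul, ← map_smul]; congr 1; ext; simp [a', b', mul_comm]
  have h1 : a * (σ b').1 = b * (σ a').1 := congrArg Prod.fst hab
  have h2 : a * (σ b').2 = b * (σ a').2 := congrArg Prod.snd hab
  have h3 : (σ a').1 * a + (σ a').2 * b = a := by
    have := congrArg Subtype.val (LinearMap.congr_fun hσ a')
    simpa [g, a'] using this
  by_cases c1 : (σ a').1 ∈ P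
  · by_cases c2 : (σ b').2 ∈ P
    · exfalso
      have : a * ((σ a').1 + (σ b').2 - 1) = 0 := by linear_combination h3 + h2
      have h4 : (1 : R) = (σ a').1 + (σ b').2 := by
        have := (mul_eq_zero.1 this).resolve_left ha
        linear_combination -this
      exact Ideal.IsPrime.ne_top ‹P.IsPrime› ((Ideal.eq_top_iff_one _).2 (h4 ▸ add_mem c1 c2))
    · exact ⟨_, c2, Or.inl ⟨(σ a').2, by linear_combination h2⟩⟩
  · exact ⟨_, c1, Or.inr ⟨(σ b').1, by linear_combination -h1⟩⟩

theorem pruefer_finset (hP : IsPruefer R) (P : Ideal R) [hp : P.IsPrime] {α : Type*}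
    (a : α → R) (t : Finset α) (ht : t.Nonempty) :
    ∃ j ∈ t, ∃ s, s ∉ P ∧ ∀ i ∈ t, a j ∣ s * a i := by
  classical
  induction ht using Finset.Nonempty.cons_induction with
  | singleton i =>
    exact ⟨i, by simp, 1, fun h => hp.ne_top ((Ideal.eq_top_iff_one _).2 h), by simp⟩
  | cons i t hi ht ih =>
    obtain ⟨j, hj, s, hs, h⟩ := ih
    obtain ⟨u, hu, h' | h'⟩ := pruefer_two hP P (a i) (a j)
    · refine ⟨j, by simp [hj], s * u, fun hh => (hp.mem_or_mem hh).elim hs hu, ?_⟩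
      intro k hk
      rcases Finset.mem_cons.1 hk with rfl | hk
      · rw [mul_assoc]; exact Dvd.dvd.mul_left h' _
      · rw [mul_comm s, mul_assoc]; exact Dvd.dvd.mul_left (h k hk) _
    · refine ⟨i, by simp, s * u, fun hh => (hp.mem_or_mem hh).elim hs hu, ?_⟩
      intro k hk
      rcases Finset.mem_cons.1 hk with rfl | hk
      · exact Dvd.dvd.mul_left dvd_rfl _
      · obtain ⟨c, hc⟩ := h k hk
        have : s * u * a k = u * a j * c := by linear_combination u * hc
        rw [this]; exact Dvd.dvd.mul_right h' _

theorem pruefer_valuationRing (hP : IsPruefer R) (P : Ideal R) [hp : P.IsPrime] :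
    ValuationRing (Localization P.primeCompl) := by
  have : IsDomain (Localization P.primeCompl) :=
    IsLocalization.isDomain_localization (Ideal.primeCompl_le_nonZeroDivisors P)
  rw [ValuationRing.iff_dvd_total]
  refine ⟨fun x y => ?_⟩
  have key : ∀ (a b : R) (s : R), s ∉ P → b ∣ s * a → ∀ u v : P.primeCompl,
      Localization.mk b u ∣ Localization.mk a v := by
    rintro a b s hs ⟨c, hc⟩ u v
    refine ⟨Localization.mk (c * u) (⟨s, hs⟩ * v), ?_⟩
    rw [Localization.mk_mul, Localization.mk_eq_mk_iff, Localization.r_iff_exists]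
    refine ⟨1, ?_⟩
    simp only [Submonoid.coe_mul, Submonoid.coe_one]
    linear_combination (u : R) * v * hc
  induction x using Localization.induction_on with | H x => ?_
  induction y using Localization.induction_on with | H y => ?_
  obtain ⟨s, hs, h | h⟩ := pruefer_two hP P x.1 y.1
  · exact Or.inr (key _ _ s hs h _ _)
  · exact Or.inl (key _ _ s hs h _ _)

theorem pruefer_pure (hP : IsPruefer R) {M : Type v} [AddCommGroup M] [Module R M]
    (A : Submodule R M) (hA : ∀ r : R, r ≠ 0 → ∀ m : M, r • m ∈ A → m ∈ A) : IsPureSub R A := by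
  have hflat : Module.Flat R (M ⧸ A) := by
    rw [Module.Flat.flat_iff_torsion_eq_bot_of_valuationRing_localization_isMaximal
      (fun P hPm => pruefer_valuationRing hP P)]
    rw [eq_bot_iff]
    rintro m ⟨⟨r, hr⟩, h⟩
    obtain ⟨m, rfl⟩ := A.mkQ_surjective m
    have h' : A.mkQ (r • m) = 0 := by simpa using h
    rw [Submodule.mkQ_apply, Submodule.Quotient.mk_eq_zero] at h'
    have := hA r (nonZeroDivisors.ne_zero hr) m h'
    simpa using this
  rintro n m r a ha ⟨x, hx⟩
  let f : (Fin n → R) →ₗ[R] (Fin m → R) := (Matrix.of r).vecMulLinear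
  let g : (Fin m → R) →ₗ[R] (M ⧸ A) := Fintype.linearCombination R (fun j => A.mkQ (x j))
  have hf : ∀ i, f (Pi.single i 1) = r i := by
    intro i; ext j; simp [f]
  have hgf : g ∘ₗ f = 0 := by
    apply LinearMap.pi_ext'
    intro i
    ext
    simp only [LinearMap.comp_apply, LinearMap.single_apply, hf, LinearMap.zero_apply]
    simp only [g, Fintype.linearCombination_apply]
    have := congrArg A.mkQ (hx i)
    rw [map_sum] at this
    simp only [map_smul] at this
    rw [this]
    simpa using ha i
  obtain ⟨k, c, y, hgy, hcf⟩ := Module.Flat.exists_factorization_of_comp_eq_zero_of_free hgf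
  obtain ⟨z, hz⟩ := Module.projective_lifting_property A.mkQ y A.mkQ_surjective
  refine ⟨fun j => x j - z (c (Pi.single j 1)), fun j => ?_, fun i => ?_⟩
  · rw [← Submodule.Quotient.mk_eq_zero, ← Submodule.mkQ_apply, map_sub, sub_eq_zero]
    have h1 : A.mkQ (z (c (Pi.single j 1))) = y (c (Pi.single j 1)) := LinearMap.congr_fun hz _
    rw [h1]
    have h2 := LinearMap.congr_fun hgy (Pi.single j 1)
    rw [LinearMap.comp_apply] at h2
    rw [← h2]
    simp [g, Fintype.linearCombination_apply_single]
  · simp only [smul_sub, Finset.sum_sub_distrib, hx]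
    rw [sub_eq_self]
    have h1 : c (r i) = 0 := by
      rw [← hf i]; exact LinearMap.congr_fun hcf _
    have h2 : r i = ∑ j, r i j • (Pi.single j 1 : Fin m → R) := by
      exact (pi_eq_sum_univ' (r i))
    rw [h2] at h1
    simp only [map_sum, map_smul] at h1
    have := congrArg z h1
    simpa only [map_sum, map_smul, map_zero] using this

end Local

section Swindle

variable {R}

theorem swindle_equiv {K G : Type*} [AddCommGroup K] [Module R K] [AddCommGroup G] [Module R G]
    (p : G →ₗ[R] K) (s : K →ₗ[R] G) (hps : ∀ k, p (s k) = k) :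
    ∃ ψ : (ℕ →₀ G) →ₗ[R] K × (ℕ →₀ G), Function.Injective ψ ∧ Function.Surjective ψ := by
  let e : G →ₗ[R] G := s ∘ₗ p
  have hpe : ∀ x, p (e x) = p x := fun x => hps _
  have hee : ∀ x, e (e x) = e x := fun x => congrArg s (hps _)
  have hes : ∀ k, e (s k) = s k := fun k => congrArg s (hps _)
  let D : (ℕ →₀ G) →ₗ[R] (ℕ →₀ G) := Finsupp.lcomapDomain Nat.succ Nat.succ_injective
  let U : (ℕ →₀ G) →ₗ[R] (ℕ →₀ G) := Finsupp.lmapDomain G R Nat.succ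
  have hD : ∀ g n, D g n = g (n + 1) := fun g n => rfl
  have hU0 : ∀ g, U g 0 = 0 := fun g => Finsupp.mapDomain_of_notMem_range _ _ (by simp)
  have hU1 : ∀ g n, U g (n + 1) = g n := fun g n =>
    Finsupp.mapDomain_apply Nat.succ_injective _ _
  let E : (ℕ →₀ G) →ₗ[R] (ℕ →₀ G) := Finsupp.mapRange.linearMap e
  have hE : ∀ g n, E g n = e (g n) := fun g n => rfl
  let ψ : (ℕ →₀ G) →ₗ[R] K × (ℕ →₀ G) :=
    (p ∘ₗ (Finsupp.lapply 0 : (ℕ →₀ G) →ₗ[R] G)).prod (((LinearMap.id : (ℕ →₀ G) →ₗ[R] (ℕ →₀ G)) - E) + E ∘ₗ D)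
  have hψ1 : ∀ g, (ψ g).1 = p (g 0) := fun g => rfl
  have hψ2 : ∀ g n, (ψ g).2 n = g n - e (g n) + e (g (n + 1)) := fun g n => rfl
  have hψinj : Function.Injective ψ := by
    rw [injective_iff_map_eq_zero]
    intro g hg
    have h0 : p (g 0) = 0 := by rw [← hψ1, hg]; rfl
    have h1 : ∀ n, g n - e (g n) + e (g (n + 1)) = 0 := by
      intro n; rw [← hψ2, hg]; rfl
    have h2 : ∀ n, e (g (n + 1)) = 0 := by
      intro n
      have := congrArg e (h1 n)
      simpa [hee] using this
    have h3 : ∀ n, e (g n) = 0 := by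
      rintro (_ | n)
      · show s (p (g 0)) = 0
        rw [h0, map_zero]
      · exact h2 n
    ext1 n
    have := h1 n
    rw [h3, h3] at this
    simpa using this
  have hψsurj : Function.Surjective ψ := by
    rintro ⟨k, h⟩
    refine ⟨Finsupp.single 0 (s k) + (h - E h) + E (U h), Prod.ext ?_ ?_⟩
    · rw [hψ1]
      simp only [Finsupp.add_apply, Finsupp.sub_apply, hE, hU0, map_add, map_sub, hpe, map_zero,
        Finsupp.single_eq_same, hps]
      simp
    · ext1 n
      rw [hψ2]
      rcases n with _ | n
      · simp only [Finsupp.add_apply, Finsupp.sub_apply, hE, hU0, hU1, map_add, map_sub, map_zero,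
          Finsupp.single_eq_same, hee, hes]
        simp
      · simp only [Finsupp.add_apply, Finsupp.sub_apply, hE, hU1, map_add, map_sub,
          hee]
        simp
  exact ⟨ψ, hψinj, hψsurj⟩

theorem exists_free_presentation {M : Type v} [AddCommGroup M] [Module R M]
    (hpd : ∃ (ι : Type v) (f : (ι →₀ R) →ₗ[R] M),
      Function.Surjective f ∧ Module.Projective R ↥(LinearMap.ker f)) :
    ∃ (I J : Type (max u v)) (φ : (J →₀ R) →ₗ[R] (I →₀ R)) (π : (I →₀ R) →ₗ[R] M),
      Function.Injective φ ∧ Function.Surjective π ∧ ∀ x, π x = 0 ↔ ∃ k, φ k = x := by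
  obtain ⟨ι, f, hf, hK⟩ := hpd
  obtain ⟨s, hs⟩ := Module.projective_def'.1 hK
  let p : (↥(LinearMap.ker f) →₀ R) →ₗ[R] ↥(LinearMap.ker f) := Finsupp.linearCombination R id
  have hps : ∀ k, p (s k) = k := fun k => LinearMap.congr_fun hs k
  obtain ⟨ψ, hψinj, hψsurj⟩ := swindle_equiv (R := R) (K := ↥(LinearMap.ker f))
    (G := ↥(LinearMap.ker f) →₀ R) p s hps
  let φ0 : (ℕ →₀ (↥(LinearMap.ker f) →₀ R)) →ₗ[R] ((ι →₀ R) × (ℕ →₀ (↥(LinearMap.ker f) →₀ R))) := (LinearMap.prodMap (LinearMap.ker f).subtype LinearMap.id) ∘ₗ ψ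
  let π0 : ((ι →₀ R) × (ℕ →₀ (↥(LinearMap.ker f) →₀ R))) →ₗ[R] M := f ∘ₗ LinearMap.fst R _ _
  let b1 := Module.Free.chooseBasis R ((ι →₀ R) × (ℕ →₀ (↥(LinearMap.ker f) →₀ R)))
  let b2 := Module.Free.chooseBasis R (ℕ →₀ (↥(LinearMap.ker f) →₀ R))
  have hφ0 : Function.Injective φ0 := by
    have : Function.Injective (LinearMap.prodMap (LinearMap.ker f).subtype (LinearMap.id (R := R) (M := ℕ →₀ (↥(LinearMap.ker f) →₀ R)))) := by
      rintro ⟨a, b⟩ ⟨c, d⟩ h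
      have h1 := congrArg Prod.fst h
      have h2 := congrArg Prod.snd h
      exact Prod.ext (Subtype.ext h1) h2
    exact this.comp hψinj
  have hex : ∀ x, π0 x = 0 ↔ ∃ k, φ0 k = x := by
    intro x
    constructor
    · intro h
      obtain ⟨k, hk⟩ := hψsurj (⟨x.1, h⟩, x.2)
      refine ⟨k, ?_⟩
      show (LinearMap.prodMap (LinearMap.ker f).subtype LinearMap.id) (ψ k) = x
      rw [hk]; rfl
    · rintro ⟨k, rfl⟩
      exact (ψ k).1.2
  refine ⟨_, _, b1.repr.toLinearMap ∘ₗ φ0 ∘ₗ b2.repr.symm.toLinearMap,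
    π0 ∘ₗ b1.repr.symm.toLinearMap, ?_, ?_, ?_⟩
  · exact b1.repr.injective.comp (hφ0.comp b2.repr.symm.injective)
  · have : Function.Surjective π0 := hf.comp Prod.fst_surjective
    exact this.comp b1.repr.symm.surjective
  · intro x
    show π0 (b1.repr.symm x) = 0 ↔ ∃ k, b1.repr (φ0 (b2.repr.symm k)) = x
    rw [hex]
    constructor
    · rintro ⟨k, hk⟩
      exact ⟨b2.repr k, by simp [hk]⟩
    · rintro ⟨k, rfl⟩
      exact ⟨b2.repr.symm k, by simp⟩

end Swindle

section Main

variable {R}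
variable {I J : Type w} {M : Type v} [AddCommGroup M] [Module R M]

/-- Residual injectivity of `φ` relative to `X` and `Y`, at all maximal ideals. -/
def PStep (φ : (J →₀ R) →ₗ[R] (I →₀ R)) (X : Set I) (Y : Set J) : Prop :=
  ∀ P : Ideal R, P.IsMaximal → ∀ k, (∀ i ∉ X, φ k i ∈ P) → ∀ j ∉ Y, k j ∈ P

/-- Good pairs of subsets. -/
def PGood (φ : (J →₀ R) →ₗ[R] (I →₀ R)) (X : Set I) (Y : Set J) : Prop :=
  (∀ y ∈ Finsupp.supported R R Y, φ y ∈ Finsupp.supported R R X) ∧ PStep φ X Y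

/-- Indices occurring in the images of the basis vectors from `Y`. -/
def pimg (φ : (J →₀ R) →ₗ[R] (I →₀ R)) (Y : Set J) : Set I :=
  ⋃ j ∈ Y, ((φ (Finsupp.single j 1)).support : Set I)

theorem pimg_countable (φ : (J →₀ R) →ₗ[R] (I →₀ R)) {Y : Set J} (hY : Y.Countable) :
    (pimg φ Y).Countable := hY.biUnion fun _ _ => Finset.countable_toSet _

theorem map_supported (φ : (J →₀ R) →ₗ[R] (I →₀ R)) {X : Set I} {Y : Set J} (h : pimg φ Y ⊆ X) :
    ∀ y ∈ Finsupp.supported R R Y, φ y ∈ Finsupp.supported R R X := by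
  intro y hy
  rw [Finsupp.supported_eq_span_single] at hy
  have : Submodule.span R ((fun i => Finsupp.single i (1 : R)) '' Y) ≤
      (Finsupp.supported R R X).comap φ := by
    rw [Submodule.span_le]
    rintro _ ⟨j, hj, rfl⟩
    rw [SetLike.mem_coe, Submodule.mem_comap, Finsupp.mem_supported]
    exact (Set.subset_biUnion_of_mem
      (u := fun j => ((φ (Finsupp.single j 1)).support : Set I)) hj).trans h
  exact this hy

theorem pimg_subset (φ : (J →₀ R) →ₗ[R] (I →₀ R)) {X : Set I} {Y : Set J}
    (h : ∀ y ∈ Finsupp.supported R R Y, φ y ∈ Finsupp.supported R R X) : pimg φ Y ⊆ X :=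
  Set.iUnion₂_subset fun j hj => (Finsupp.mem_supported R _).1
    (h _ (Finsupp.single_mem_supported R _ hj))

theorem local_split (hP : IsPruefer R) (P : Ideal R) [P.IsPrime] (k : J →₀ R) (Y : Set J)
    (hk : ∃ j ∉ Y, k j ≠ 0) :
    ∃ s, s ∉ P ∧ ∃ c : R, c ≠ 0 ∧ ∃ k' : J →₀ R, (∃ j ∉ Y, k' j ∉ P) ∧
      s • k - c • k' ∈ Finsupp.supported R R Y := by
  classical
  let t := k.support.filter (fun j => j ∉ Y)
  have hmem : ∀ j, j ∈ t ↔ k j ≠ 0 ∧ j ∉ Y := fun j => by simp [t]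
  obtain ⟨j1, hj1, hj1'⟩ := hk
  obtain ⟨j, hj, s, hs, h⟩ := pruefer_finset hP P k t ⟨j1, (hmem j1).2 ⟨hj1', hj1⟩⟩
  choose c hc using h
  refine ⟨s, hs, k j, ((hmem j).1 hj).1, Finsupp.indicator t c, ⟨j, ((hmem j).1 hj).2, ?_⟩, ?_⟩
  · rw [Finsupp.indicator_of_mem hj]
    have := hc j hj
    rw [mul_comm] at this
    rwa [← mul_left_cancel₀ ((hmem j).1 hj).1 this]
  · rw [Finsupp.mem_supported']
    intro i hi
    by_cases hit : i ∈ t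
    · simp [Finsupp.indicator_of_mem hit, hc i hit]
    · have : k i = 0 := by
        by_contra h
        exact hit ((hmem i).2 ⟨h, hi⟩)
      simp [Finsupp.indicator_of_notMem hit, this]

theorem good_split (hP : IsPruefer R) {φ : (J →₀ R) →ₗ[R] (I →₀ R)} {X : Set I} {Y : Set J}
    (hG : PGood φ X Y) (P : Ideal R) [hPm : P.IsMaximal] (k : J →₀ R)
    (hk : k ∉ Finsupp.supported R R Y) :
    ∃ s, s ∉ P ∧ ∃ c : R, c ≠ 0 ∧ ∃ k' : J →₀ R, (∃ i ∉ X, φ k' i ∉ P) ∧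
      ∀ i ∉ X, s * φ k i = c * φ k' i := by
  rw [Finsupp.mem_supported'] at hk
  push Not at hk
  obtain ⟨s, hs, c, hc, k', ⟨j, hj, hj'⟩, h⟩ := local_split hP P k Y hk
  refine ⟨s, hs, c, hc, k', ?_, ?_⟩
  · by_contra hcon
    push Not at hcon
    exact hj' (hG.2 P hPm k' hcon j hj)
  · intro i hi
    have := (Finsupp.mem_supported' R _).1 (hG.1 _ h) i hi
    rw [map_sub, map_smul, map_smul] at this
    simpa [sub_eq_zero] using this

theorem good_inter (hP : IsPruefer R) {φ : (J →₀ R) →ₗ[R] (I →₀ R)} {X : Set I} {Y : Set J}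
    (hG : PGood φ X Y) (k : J →₀ R) (hk : φ k ∈ Finsupp.supported R R X) :
    k ∈ Finsupp.supported R R Y := by
  by_contra hcon
  obtain ⟨P, hPm⟩ := Ideal.exists_maximal R
  obtain ⟨s, hs, c, hc, k', ⟨i, hi, hi'⟩, h⟩ := good_split hP hG P k hcon
  have h1 := h i hi
  rw [(Finsupp.mem_supported' R _).1 hk i hi, mul_zero] at h1
  rcases mul_eq_zero.1 h1.symm with h2 | h2
  · exact hc h2
  · exact hi' (h2 ▸ zero_mem P)

theorem good_pure (hP : IsPruefer R) {φ : (J →₀ R) →ₗ[R] (I →₀ R)} {π : (I →₀ R) →ₗ[R] M}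
    (hπ : Function.Surjective π) (hex : ∀ x, π x = 0 ↔ ∃ k, φ k = x)
    {X : Set I} {Y : Set J}
    (hG : PGood φ X Y) (r : R) (hr : r ≠ 0) (m : M)
    (hm : r • m ∈ (Finsupp.supported R R X).map π) : m ∈ (Finsupp.supported R R X).map π := by
  obtain ⟨f, rfl⟩ := hπ m
  obtain ⟨x, hx, hxf⟩ := hm
  obtain ⟨k, hk⟩ := (hex (r • f - x)).1 (by rw [map_sub, map_smul, hxf, sub_self])
  rw [SetLike.mem_coe, Finsupp.mem_supported'] at hx
  have hki : ∀ i ∉ X, φ k i = r * f i := by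
    intro i hi
    rw [hk]; simp [hx i hi]
  by_cases hkY : k ∈ Finsupp.supported R R Y
  · refine ⟨f, (Finsupp.mem_supported' R _).2 fun i hi => ?_, rfl⟩
    have h1 := (Finsupp.mem_supported' R _).1 (hG.1 k hkY) i hi
    rw [hki i hi] at h1
    exact (mul_eq_zero.1 h1).resolve_left hr
  set A := (Finsupp.supported R R X).map π with hA
  let T : Ideal R := A.comap (LinearMap.toSpanSingleton R M (π f))
  have hT : T = ⊤ := by
    by_contra hne
    obtain ⟨P, hPm, hTP⟩ := Ideal.exists_le_maximal T hne
    obtain ⟨s, hs, c, hc, k', ⟨i, hi, hi'⟩, h⟩ := good_split hP hG P k hkY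
    have hmem : φ k' i * s ∈ T := by
      show (LinearMap.toSpanSingleton R M (π f)) (φ k' i * s) ∈ A
      rw [LinearMap.toSpanSingleton_apply]
      refine ⟨(φ k' i * s) • f - φ ((s * f i) • k'), (Finsupp.mem_supported' R _).2 ?_, ?_⟩
      · intro i' hi2
        have h1 := h i hi
        have h2 := h i' hi2
        rw [hki i hi] at h1
        rw [hki i' hi2] at h2
        apply (mul_eq_zero.1 (?_ : r * _ = 0)).resolve_left hr
        rw [map_smul]
        simp only [Finsupp.sub_apply, Finsupp.smul_apply, smul_eq_mul]
        linear_combination φ k' i * h2 - φ k' i' * h1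
      · rw [map_sub, (hex _).2 ⟨_, rfl⟩, sub_zero, map_smul]
    rcases hPm.isPrime.mem_or_mem (hTP hmem) with h1 | h1
    · exact hi' h1
    · exact hs h1
  have : (1 : R) ∈ T := hT ▸ Submodule.mem_top
  have h2 : (LinearMap.toSpanSingleton R M (π f)) 1 ∈ A := this
  simpa using h2

theorem good_empty [NoZeroSMulDivisors R M] (hP : IsPruefer R) {φ : (J →₀ R) →ₗ[R] (I →₀ R)}
    {π : (I →₀ R) →ₗ[R] M} (hφ : Function.Injective φ)
    (hex : ∀ x, π x = 0 ↔ ∃ k, φ k = x) : PGood φ ∅ ∅ := by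
  constructor
  · intro y hy
    rw [Finsupp.supported_empty, Submodule.mem_bot] at hy
    rw [hy, map_zero]; exact zero_mem _
  intro P hPm k hk j _
  by_cases h0 : φ k = 0
  · rw [hφ (h0.trans (map_zero φ).symm)]
    exact zero_mem P
  obtain ⟨i, hi⟩ : ∃ i, φ k i ≠ 0 := by
    by_contra hcon
    push Not at hcon
    exact h0 (Finsupp.ext hcon)
  obtain ⟨i, hit, s, hs, h⟩ := pruefer_finset hP P (φ k) (φ k).support
    ⟨i, Finsupp.mem_support_iff.2 hi⟩
  choose c hc using h
  have hd : φ (s • k) = φ k i • Finsupp.indicator (φ k).support c := by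
    ext i'
    by_cases hi' : i' ∈ (φ k).support
    · simp [Finsupp.indicator_of_mem hi', hc i' hi']
    · simp [Finsupp.indicator_of_notMem hi', Finsupp.notMem_support_iff.1 hi']
  have h1 : φ k i • π (Finsupp.indicator (φ k).support c) = 0 := by
    rw [← map_smul, ← hd]; exact (hex _).2 ⟨_, rfl⟩
  have h2 := (eq_zero_or_eq_zero_of_smul_eq_zero h1).resolve_left (Finsupp.mem_support_iff.1 hit)
  obtain ⟨k2, hk2⟩ := (hex _).1 h2
  have h3 : s • k = φ k i • k2 := hφ (by rw [hd, map_smul, hk2])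
  have h4 : s * k j = φ k i * k2 j := by simpa using DFunLike.congr_fun h3 j
  have h5 : s * k j ∈ P := h4 ▸ P.mul_mem_right _ (hk i (by simp))
  exact (hPm.isPrime.mem_or_mem h5).resolve_left hs

theorem step_union {φ : (J →₀ R) →ₗ[R] (I →₀ R)} {T : Type*} [Nonempty T] (X : T → Set I)
    (Y : T → Set J) (hX : Directed (· ⊆ ·) X) (h : ∀ t, PStep φ (X t) (Y t)) :
    PStep φ (⋃ t, X t) (⋃ t, Y t) := by
  classical
  intro P hPm k hk j hj
  obtain ⟨t, ht⟩ := hX.exists_mem_subset_of_finset_subset_biUnion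
    (s := (φ k).support.filter (fun i => φ k i ∉ P)) (by
      intro i hi
      by_contra hcon
      simp only [Finset.coe_filter, Set.mem_ofPred_eq] at hi
      exact hi.2 (hk i hcon))
  refine h t P hPm k (fun i hi => ?_) j (fun hjt => hj (Set.mem_iUnion.2 ⟨t, hjt⟩))
  by_contra hcon
  refine hi (ht ?_)
  simp only [Finset.coe_filter, Set.mem_ofPred_eq]
  exact ⟨Finsupp.mem_support_iff.2 fun h0 => hcon (h0 ▸ zero_mem P), hcon⟩

theorem step_one {φ : (J →₀ R) →ₗ[R] (I →₀ R)} {X0 : Set I} {Y0 : Set J}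
    (h0 : PStep φ X0 Y0) (D : Set I) (hD : D.Countable) (P : Ideal R) (hPm : P.IsMaximal) :
    ∃ Z : Set J, Z.Countable ∧ ∀ k, (∀ i ∉ X0 ∪ D, φ k i ∈ P) → ∀ j ∉ Y0 ∪ Z, k j ∈ P := by
  classical
  let _ : Field (R ⧸ P) := Ideal.Quotient.field P
  let θ : (J →₀ R) →ₗ[R] (D →₀ (R ⧸ P)) :=
    (Finsupp.mapRange.linearMap P.mkQ) ∘ₗ (Finsupp.lsubtypeDomain D) ∘ₗ φ
  have hθ : ∀ k (i : D), θ k i = Ideal.Quotient.mk P (φ k i) := fun k i => rfl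
  let V : Set (J →₀ R) := {k | ∀ i ∉ X0 ∪ D, φ k i ∈ P}
  obtain ⟨b, hbV, hbs, hbi⟩ := exists_linearIndependent (R ⧸ P) (θ '' V)
  have hbc : b.Countable := by
    rw [← Cardinal.le_aleph0_iff_set_countable]
    refine hbi.cardinal_le_rank.trans ?_
    have : Countable D := hD
    rw [rank_finsupp_self]
    simp
  have hbV' : ∀ x, x ∈ b → ∃ k, k ∈ V ∧ θ k = x := fun x hx => hbV hx
  choose! g hgV hg using hbV'
  refine ⟨⋃ x ∈ b, ((g x).support : Set J), hbc.biUnion fun _ _ => Finset.countable_toSet _, ?_⟩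
  intro k hk j hj
  have h1 : θ k ∈ Submodule.span R b := by
    have : θ k ∈ Submodule.span (R ⧸ P) b := hbs ▸ Submodule.subset_span ⟨k, hk, rfl⟩
    rw [← Submodule.restrictScalars_span R (R ⧸ P) Ideal.Quotient.mk_surjective]
    exact this
  have h2 : b ⊆ θ '' (g '' b) := by
    intro x hx
    exact ⟨g x, ⟨x, hx, rfl⟩, hg x hx⟩
  have h3 := Submodule.span_mono h2 h1
  rw [Submodule.span_image] at h3
  obtain ⟨l, hl, hlk⟩ := h3
  have hlV : ∀ i ∉ X0 ∪ D, φ l i ∈ P := by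
    intro i hi
    have : Submodule.span R (g '' b) ≤
        Submodule.comap ((Finsupp.lapply i : (I →₀ R) →ₗ[R] R) ∘ₗ φ) P := by
      rw [Submodule.span_le]
      rintro _ ⟨x, hx, rfl⟩
      exact hgV x hx i hi
    exact this hl
  have hlj : l j = 0 := by
    have : Submodule.span R (g '' b) ≤
        Finsupp.supported R R (⋃ x ∈ b, ((g x).support : Set J)) := by
      rw [Submodule.span_le]
      rintro _ ⟨x, hx, rfl⟩
      rw [SetLike.mem_coe, Finsupp.mem_supported]
      exact Set.subset_biUnion_of_mem (u := fun x => ((g x).support : Set J)) hx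
    exact (Finsupp.mem_supported' R _).1 (this hl) j fun h => hj (Or.inr h)
  have h4 : (k - l) j ∈ P := by
    refine h0 P hPm (k - l) (fun i hi => ?_) j (fun h => hj (Or.inl h))
    rw [map_sub, Finsupp.sub_apply]
    by_cases hiD : i ∈ D
    · rw [← Ideal.Quotient.eq, ← hθ k ⟨i, hiD⟩, ← hθ l ⟨i, hiD⟩, hlk]
    · have : i ∉ X0 ∪ D := fun h => h.elim hi hiD
      exact sub_mem (hk i this) (hlV i this)
  simpa [hlj] using h4

theorem step_all (hcount : {m : Ideal R | m.IsMaximal}.Countable)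
    {φ : (J →₀ R) →ₗ[R] (I →₀ R)} {X0 : Set I} {Y0 : Set J}
    (h0 : PStep φ X0 Y0) (D : Set I) (hD : D.Countable) :
    ∃ Z : Set J, Z.Countable ∧ PStep φ (X0 ∪ D) (Y0 ∪ Z) := by
  choose! Z hZ h using step_one h0 D hD
  refine ⟨⋃ P ∈ {m : Ideal R | m.IsMaximal}, Z P, hcount.biUnion hZ, ?_⟩
  intro P hPm k hk j hj
  refine h P hPm k hk j fun hcon => hj ?_
  rcases hcon with h1 | h1
  · exact Or.inl h1
  · exact Or.inr (Set.mem_biUnion (t := Z) (show P ∈ {m : Ideal R | m.IsMaximal} from hPm) h1)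

theorem good_extend (hcount : {m : Ideal R | m.IsMaximal}.Countable)
    {φ : (J →₀ R) →ₗ[R] (I →₀ R)} {X0 : Set I} {Y0 : Set J}
    (h0 : PGood φ X0 Y0) (i : I) :
    ∃ (X : Set I) (Y : Set J), PGood φ X Y ∧ X0 ⊆ X ∧ Y0 ⊆ Y ∧ i ∈ X ∧
      (X \ X0).Countable ∧ (Y \ Y0).Countable := by
  choose! Z hZ h using step_all hcount h0.2
  let D : ℕ → Set I := fun n => Nat.rec {i} (fun _ E => E ∪ pimg φ (Z E)) n
  have hDs : ∀ n, D (n + 1) = D n ∪ pimg φ (Z (D n)) := fun n => rfl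
  have hD : ∀ n, (D n).Countable := by
    intro n
    induction n with
    | zero => exact Set.countable_singleton i
    | succ n ih => rw [hDs]; exact ih.union (pimg_countable φ (hZ _ ih))
  have hmono : Monotone D := monotone_nat_of_le_succ fun n => by
    rw [hDs]; exact Set.subset_union_left
  refine ⟨⋃ n, (X0 ∪ D n), ⋃ n, (Y0 ∪ Z (D n)), ⟨?_, ?_⟩, ?_, ?_, ?_, ?_, ?_⟩
  · apply map_supported
    refine Set.iUnion₂_subset fun j hj => ?_
    obtain ⟨n, hn | hn⟩ := Set.mem_iUnion.1 hj
    · refine Set.Subset.trans ?_ ((Set.subset_union_left (t := D 0)).trans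
        (Set.subset_iUnion (fun n => X0 ∪ D n) 0))
      exact (Finsupp.mem_supported R _).1 (h0.1 _ (Finsupp.single_mem_supported R _ hn))
    · refine Set.Subset.trans ?_ (Set.subset_iUnion (fun n => X0 ∪ D n) (n + 1))
      refine Set.Subset.trans ?_ Set.subset_union_right
      rw [hDs]
      refine Set.Subset.trans ?_ Set.subset_union_right
      exact Set.subset_biUnion_of_mem
        (u := fun j => ((φ (Finsupp.single j 1)).support : Set I)) hn
  · refine step_union _ _ (Monotone.directed_le ?_) fun n => h _ (hD n)
    intro a b hab
    exact Set.union_subset_union_right _ (hmono hab)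
  · exact Set.subset_union_left.trans (Set.subset_iUnion (fun n => X0 ∪ D n) 0)
  · exact Set.subset_union_left.trans (Set.subset_iUnion (fun n => Y0 ∪ Z (D n)) 0)
  · exact Set.mem_iUnion.2 ⟨0, Or.inr rfl⟩
  · refine (Set.countable_iUnion hD).mono ?_
    rintro x ⟨hx, hx0⟩
    obtain ⟨n, hn⟩ := Set.mem_iUnion.1 hx
    exact Set.mem_iUnion.2 ⟨n, hn.resolve_left hx0⟩
  · refine (Set.countable_iUnion fun n => hZ _ (hD n)).mono ?_
    rintro x ⟨hx, hx0⟩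
    obtain ⟨n, hn⟩ := Set.mem_iUnion.1 hx
    exact Set.mem_iUnion.2 ⟨n, hn.resolve_left hx0⟩

theorem inter_countable (hP : IsPruefer R) {φ : (J →₀ R) →ₗ[R] (I →₀ R)}
    {π : (I →₀ R) →ₗ[R] M} (hex : ∀ x, π x = 0 ↔ ∃ k, φ k = x)
    {X0 X1 : Set I} {Y0 Y1 : Set J} (h0 : PGood φ X0 Y0) (h1 : PGood φ X1 Y1)
    (hX : X0 ⊆ X1) (hY : (Y1 \ Y0).Countable) :
    ∃ Z : Set I, Z.Countable ∧ Z ⊆ X0 ∧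
      (Finsupp.supported R R (X1 \ X0)).map π ⊓ (Finsupp.supported R R X0).map π ≤
        (Finsupp.supported R R Z).map π := by
  classical
  refine ⟨X0 ∩ pimg φ (Y1 \ Y0), (pimg_countable φ hY).mono Set.inter_subset_right,
    Set.inter_subset_left, ?_⟩
  rintro _ ⟨⟨x, hx, rfl⟩, ⟨x0, hx0, hxx⟩⟩
  obtain ⟨k, hk⟩ := (hex (x - x0)).1 (by rw [map_sub, hxx, sub_self])
  have hkY : k ∈ Finsupp.supported R R Y1 := by
    apply good_inter hP h1
    rw [hk]
    exact sub_mem (Finsupp.supported_mono Set.sdiff_subset hx) (Finsupp.supported_mono hX hx0)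
  rw [Finsupp.mem_supported'] at hkY
  let k0 := k.filter (fun j => j ∈ Y0)
  let k1 := k.filter (fun j => ¬ j ∈ Y0)
  have hk01 : k0 + k1 = k := Finsupp.filter_add_filter_not k _
  have hk0 : k0 ∈ Finsupp.supported R R Y0 := by
    rw [Finsupp.mem_supported']
    intro j hj
    exact Finsupp.filter_apply_neg _ _ hj
  have hk1 : k1 ∈ Finsupp.supported R R (Y1 \ Y0) := by
    rw [Finsupp.mem_supported']
    intro j hj
    by_cases hj0 : j ∈ Y0
    · exact Finsupp.filter_apply_neg _ _ (not_not.2 hj0)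
    · refine (Finsupp.filter_apply_pos (fun j => ¬ j ∈ Y0) _ hj0).trans ?_
      exact hkY j fun h => hj ⟨h, hj0⟩
  have hA := add_mem hx0 (h0.1 k0 hk0)
  rw [Finsupp.mem_supported'] at hA
  have hB := (Finsupp.mem_supported' R _).1 (map_supported φ subset_rfl k1 hk1)
  have hx' := (Finsupp.mem_supported' R _).1 hx
  have heq : x0 + φ k0 = x - φ k1 := by
    have : φ k0 + φ k1 = x - x0 := by rw [← map_add, hk01, hk]
    rw [← sub_eq_zero] at this ⊢
    rw [← this]; abel
  refine ⟨x0 + φ k0, (Finsupp.mem_supported' R _).2 fun z hz => ?_, ?_⟩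
  · by_cases hz0 : z ∈ X0
    · rw [heq, Finsupp.sub_apply, hx' z (fun h => h.2 hz0), hB z fun h => hz ⟨hz0, h⟩, sub_zero]
    · exact hA z hz0
  · rw [map_add, (hex _).2 ⟨k0, rfl⟩, add_zero, hxx]

theorem main_family [NoZeroSMulDivisors R M] (hP : IsPruefer R)
    (hcount : {m : Ideal R | m.IsMaximal}.Countable)
    {φ : (J →₀ R) →ₗ[R] (I →₀ R)}
    {π : (I →₀ R) →ₗ[R] M} (hφ : Function.Injective φ) (hπ : Function.Surjective π)
    (hex : ∀ x, π x = 0 ↔ ∃ k, φ k = x) :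
    ∃ 𝓑 : Set (Submodule R M), IsGAleph0Family R 𝓑 ∧
      ∀ A ∈ 𝓑, ∀ r : R, r ≠ 0 → ∀ m : M, r • m ∈ A → m ∈ A := by
  obtain ⟨_, hwf⟩ := exists_wellFoundedLT I
  have hext : ∀ (p : Set I × Set J) (i : I), ∃ q : Set I × Set J, PGood φ p.1 p.2 →
      (PGood φ q.1 q.2 ∧ p.1 ⊆ q.1 ∧ p.2 ⊆ q.2 ∧ i ∈ q.1 ∧
        (q.1 \ p.1).Countable ∧ (q.2 \ p.2).Countable) := by
    intro p i
    by_cases hp : PGood φ p.1 p.2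
    · obtain ⟨X, Y, h⟩ := good_extend hcount hp i
      exact ⟨(X, Y), fun _ => h⟩
    · exact ⟨p, fun h => absurd h hp⟩
  choose ext hext using hext
  let G : I → Set I × Set J := (wellFounded_lt (α := I)).fix fun i g =>
    ext (⋃ j : Set.Iio i, (g j.1 j.2).1, ⋃ j : Set.Iio i, (g j.1 j.2).2) i
  let Lo : I → Set I × Set J := fun i =>
    (⋃ j : Set.Iio i, (G j.1).1, ⋃ j : Set.Iio i, (G j.1).2)
  have hGL : ∀ i, G i = ext (Lo i) i := fun i => (wellFounded_lt (α := I)).fix_eq _ i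
  have hL1 : ∀ {i j}, j < i → (G j).1 ⊆ (Lo i).1 := fun {i j} h =>
    Set.subset_iUnion (fun j : Set.Iio i => (G j.1).1) ⟨j, h⟩
  have hL2 : ∀ {i j}, j < i → (G j).2 ⊆ (Lo i).2 := fun {i j} h =>
    Set.subset_iUnion (fun j : Set.Iio i => (G j.1).2) ⟨j, h⟩
  have hLgood : ∀ i, PGood φ (Lo i).1 (Lo i).2 := by
    intro i
    induction i using WellFoundedLT.induction with
    | ind i ih =>
      have hg : ∀ j, j < i → _ := fun j hj => hext (Lo j) j (ih j hj)
      simp only [← hGL] at hg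
      rcases isEmpty_or_nonempty (Set.Iio i) with he | he
      · have h1 : (Lo i).1 = ∅ := Set.iUnion_of_empty _
        have h2 : (Lo i).2 = ∅ := Set.iUnion_of_empty _
        rw [h1, h2]
        exact good_empty hP hφ hex
      · constructor
        · apply map_supported
          refine Set.iUnion₂_subset fun y hy => ?_
          obtain ⟨⟨j, hj⟩, hyj⟩ := Set.mem_iUnion.1 hy
          refine Set.Subset.trans ?_ (hL1 hj)
          exact (Finsupp.mem_supported R _).1
            ((hg j hj).1.1 _ (Finsupp.single_mem_supported R _ hyj))
        · refine step_union _ _ (Monotone.directed_le ?_) fun j => (hg j.1 j.2).1.2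
          intro a b hab
          rcases eq_or_lt_of_le hab with h | h
          · rw [h]
          · exact (hL1 h).trans (hg b.1 b.2).2.1
  have hg : ∀ i, _ := fun i => hext (Lo i) i (hLgood i)
  simp only [← hGL] at hg
  let B : I → Submodule R M := fun i => (Finsupp.supported R R ((G i).1 \ (Lo i).1)).map π
  have hsumB : ∀ S : Set I, IsLowerSet S →
      hsum R B S = (Finsupp.supported R R (⋃ j : S, (G j.1).1)).map π := by
    intro S hS
    apply le_antisymm
    · refine iSup_le fun j => Submodule.map_mono (Finsupp.supported_mono ?_)
      exact Set.sdiff_subset.trans (Set.subset_iUnion (fun j : S => (G j.1).1) j)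
    · rw [Finsupp.supported_eq_span_single, Submodule.map_span, Submodule.span_le]
      rintro _ ⟨_, ⟨x, hx, rfl⟩, rfl⟩
      obtain ⟨⟨j, hj⟩, hxj⟩ := Set.mem_iUnion.1 hx
      obtain ⟨j0, hj0, hmin⟩ := (wellFounded_lt (α := I)).has_min {j | x ∈ (G j).1} ⟨j, hxj⟩
      have hj0S : j0 ∈ S := hS (not_lt.1 (hmin j hxj)) hj
      refine le_hsum B hj0S ⟨_, Finsupp.single_mem_supported R _ ⟨hj0, fun hcon => ?_⟩, rfl⟩
      obtain ⟨⟨l, hl⟩, hxl⟩ := Set.mem_iUnion.1 hcon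
      exact hmin l hxl hl
  have hIio : ∀ i, hsum R B (Set.Iio i) = (Finsupp.supported R R (Lo i).1).map π := fun i =>
    hsumB _ (isLowerSet_Iio i)
  refine hill_family B ?_ ?_ ?_ ?_
  · rw [hsumB _ isLowerSet_univ]
    have : (⋃ j : (Set.univ : Set I), (G j.1).1) = Set.univ := by
      rw [Set.eq_univ_iff_forall]
      intro i
      exact Set.mem_iUnion.2 ⟨⟨i, trivial⟩, (hg i).2.2.2.1⟩
    rw [this, Finsupp.supported_univ, Submodule.map_top, LinearMap.range_eq_top.2 hπ]
  · intro i
    refine ⟨π '' ((fun i => Finsupp.single i (1 : R)) '' ((G i).1 \ (Lo i).1)),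
      ((hg i).2.2.2.2.1.image _).image _, ?_⟩
    rw [← Submodule.map_span, ← Finsupp.supported_eq_span_single]
  · intro i r hr m hm
    rw [hIio] at hm ⊢
    exact good_pure hP hπ hex (hLgood i) r hr m hm
  · intro i
    obtain ⟨Z, hZ, hZX, h⟩ := inter_countable hP hex (hLgood i) (hg i).1 (hg i).2.1
      (hg i).2.2.2.2.2
    refine ⟨π '' ((fun i => Finsupp.single i (1 : R)) '' Z), (hZ.image _).image _, ?_, ?_⟩
    · rw [hIio]
      rintro _ ⟨_, ⟨z, hz, rfl⟩, rfl⟩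
      exact ⟨_, Finsupp.single_mem_supported R _ (hZX hz), rfl⟩
    · rw [hIio, ← Submodule.map_span, ← Finsupp.supported_eq_span_single]
      exact h

end Main

/-- over a Prüfer domain with countably many maximal ideals, every
torsion-free module of projective dimension at most 1 has a `G(ℵ₀)`-family of pure
submodules. -/
theorem stmt13 (hP : IsPruefer R)
    (hcount : {m : Ideal R | m.IsMaximal}.Countable)
    {M : Type v} [AddCommGroup M] [Module R M] [NoZeroSMulDivisors R M]
    (hpd : ∃ (ι : Type v) (f : (ι →₀ R) →ₗ[R] M),
      Function.Surjective f ∧ Module.Projective R ↥(LinearMap.ker f)) :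
    ∃ 𝓑 : Set (Submodule R M), IsGAleph0Family R 𝓑 ∧ ∀ A ∈ 𝓑, IsPureSub R A := by
  obtain ⟨I, J, φ, π, hφ, hπ, hex⟩ := exists_free_presentation hpd
  obtain ⟨𝓑, h1, h2⟩ := main_family hP hcount hφ hπ hex
  exact ⟨𝓑, h1, fun A hA => pruefer_pure hP A (h2 A hA)⟩
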